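/- arXiv:2002.05288 — 3 statements merged into one kernel-verified Lean document; each statement's English description precedes it below -/
import Mathlib

section
/- Let G be a simple graph in which every cycle has length divisible by 4, with vertex bipartition {V_α, V_β}. Then for every vertex v ∈ V_β, for every 2-colouring a : V_α → {1, 2}, and for every prescribed colour c ∈ {1, 2}, there exists a 2-colouring b : V_β → {1, 2} such that: (1) no cycle of G is monochromatic with respect to the combined colouring a ▽ b; (2) for every path in G whose two endpoints are of type β and all of whose inner vertices have degree 2 in G, the type-β vertices along that path are coloured 1 and 2 alternately by b; and (3) b(v) = c. -/
open SimpleGraph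

/-- A graph has *multi-4-cycles* if every cycle has length divisible by `4`. -/
def Multi4 {V : Type*} (G : SimpleGraph V) : Prop :=
  ∀ ⦃u : V⦄ (c : G.Walk u u), c.IsCycle → 4 ∣ c.length

/-- `A` and its complement form a bipartition of `G`: every edge joins `A` (type α)
to its complement (type β). -/
def Bipartition {V : Type*} (G : SimpleGraph V) (A : Set V) : Prop :=
  ∀ ⦃u w : V⦄, G.Adj u w → (u ∈ A ↔ w ∉ A)

/-- A graph is 2-connected: connected, at least three vertices, and no cut vertex. -/
def TwoConn {W : Type*} (G : SimpleGraph W) : Prop :=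
  G.Connected ∧ (∃ a b c : W, a ≠ b ∧ a ≠ c ∧ b ≠ c) ∧
    ∀ v : W, (G.induce ({v}ᶜ : Set W)).Preconnected

/-- The set of inner vertices of a walk from `x` to `y`. -/
def innSet {W : Type*} {G : SimpleGraph W} {x y : W} (P : G.Walk x y) : Set W :=
  {w | w ∈ P.support ∧ w ≠ x ∧ w ≠ y}

namespace SimpleGraph

variable {V : Type*} {G H H₁ H₂ : SimpleGraph V} {A : Set V}

theorem Walk.IsPath.append_of_inter {u v w : V} {p : G.Walk u v} {q : G.Walk v w}
    (hp : p.IsPath) (hq : q.IsPath) (h : ∀ x ∈ p.support, x ∈ q.support → x = v) :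
    (p.append q).IsPath := by
  rw [Walk.isPath_def, Walk.support_append, List.nodup_append']
  refine ⟨hp.support_nodup, hq.support_nodup.tail, fun x hx hx' => ?_⟩
  have hxv := h x hx (List.mem_of_mem_tail hx')
  subst hxv
  have := hq.support_nodup
  rw [← Walk.cons_tail_support, List.nodup_cons] at this
  exact this.1 hx'

/-- In a multi-4-cycle graph the lengths of two distinct internally disjoint paths with common
endpoints add up to a multiple of `4`. -/
theorem four_dvd_length_add_length (hG : Multi4 G) {u v : V} (huv : u ≠ v) {p q : G.Walk u v}
    (hp : p.IsPath) (hq : q.IsPath) (hne : p ≠ q)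
    (h : ∀ x ∈ p.support, x ∈ q.support → x = u ∨ x = v) :
    4 ∣ p.length + q.length := by
  have hc : (p.append q.reverse).IsCycle := by
    refine hp.isCycle_append hq.reverse (fun x hx hx' => ?_) ?_
    · have hxp := List.mem_of_mem_tail hx
      have hxq : x ∈ q.support := by
        simpa using List.mem_of_mem_tail hx'
      rcases h x hxp hxq with rfl | rfl
      · have := hp.support_nodup
        rw [← Walk.cons_tail_support, List.nodup_cons] at this
        exact this.1 hx
      · have := hq.reverse.support_nodup
        rw [← Walk.cons_tail_support, List.nodup_cons] at this
        exact this.1 hx'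
    · by_contra! hlen
      rw [Walk.length_reverse] at hlen
      exact hne (by grind [Walk.eq_of_length_le_one])
  simpa using hG _ hc

theorem Walk.exists_isPath_even_add_length
    (hG : ∀ (u : V) (c : G.Walk u u), c.IsCycle → Even c.length)
    {u v : V} (p : G.Walk u v) : ∃ q : G.Walk u v, q.IsPath ∧ Even (p.length + q.length) := by
  classical
  induction p with
  | nil => exact ⟨.nil, .nil, by simp⟩
  | @cons u w v h p ih =>
    obtain ⟨q, hq, he⟩ := ih
    by_cases hu : u ∈ q.support
    · refine ⟨q.dropUntil u hu, hq.dropUntil hu, ?_⟩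
      have hlen : (q.takeUntil u hu).length + (q.dropUntil u hu).length = q.length := by
        rw [← Walk.length_append, Walk.take_spec]
      have hodd : Even ((q.takeUntil u hu).length + 1) := by
        by_cases hmem : s(u, w) ∈ (q.takeUntil u hu).edges
        · have := (hq.takeUntil hu).length_eq_one_of_mem_edges (by rwa [Sym2.eq_swap] at hmem)
          rw [this]; decide
        · exact hG u _ ((Walk.cons_isCycle_iff _ h).2 ⟨hq.takeUntil hu, hmem⟩)
      rw [Walk.length_cons]
      grind
    · exact ⟨.cons h q, hq.cons hu, by simp only [Walk.length_cons]; grind⟩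

theorem colorable_two_of_even_cycles (hG : ∀ (u : V) (c : G.Walk u u), c.IsCycle → Even c.length) :
    G.Colorable 2 := by
  rw [two_colorable_iff_forall_loop_even]
  intro u w
  obtain ⟨q, hq, he⟩ := w.exists_isPath_even_add_length hG
  have : q.length = 0 := by
    cases q with
    | nil => rfl
    | cons h q => exact absurd q.end_mem_support ((Walk.cons_isPath_iff _ _).1 hq).2
  simpa [this] using he

/-- A walk leaving `S` from outside can be shortened to a path stopping at its first vertex in
`S`. -/
theorem Walk.exists_isPath_inter_eq_end {u v : V} (p : G.Walk u v) {S : Set V} (hv : v ∈ S) :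
    ∃ w ∈ S, ∃ q : G.Walk u w, q.IsPath ∧ (∀ x ∈ q.support, x ∈ p.support) ∧
      ∀ x ∈ q.support, x ∈ S → x = w := by
  classical
  suffices ∃ w ∈ S, ∃ q : G.Walk u w, (∀ x ∈ q.support, x ∈ p.support) ∧
      ∀ x ∈ q.support, x ∈ S → x = w by
    obtain ⟨w, hw, q, hqp, hqS⟩ := this
    exact ⟨w, hw, q.bypass, q.bypass_isPath, fun x hx => hqp x (q.support_bypass_subset_support hx),
      fun x hx => hqS x (q.support_bypass_subset_support hx)⟩
  induction p with
  | nil => exact ⟨_, hv, .nil, by simp, by simp⟩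
  | @cons u' _ _ h p ih =>
    by_cases hu : u' ∈ S
    · exact ⟨u', hu, .nil, by simp, by simp⟩
    · obtain ⟨w, hw, q, hqp, hqS⟩ := ih hv
      exact ⟨w, hw, .cons h q, by grind [Walk.support_cons], by grind [Walk.support_cons]⟩

theorem Walk.IsPath.eq_of_mem_takeUntil_of_mem_dropUntil [DecidableEq V] {u v w x : V}
    {p : G.Walk u v} (hp : p.IsPath) (hw : w ∈ p.support) (h₁ : x ∈ (p.takeUntil w hw).support)
    (h₂ : x ∈ (p.dropUntil w hw).support) : x = w := by
  rw [← Walk.take_spec p hw, Walk.isPath_def, Walk.support_append, List.nodup_append'] at hp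
  by_contra hne
  rw [Walk.mem_support_iff] at h₂
  exact hp.2.2 h₁ (h₂.resolve_left hne)

/-- Any two non-isolated vertices are joined by a walk avoiding any given third vertex. -/
def NoCutVertex (G : SimpleGraph V) : Prop :=
  ∀ ⦃t p q : V⦄, p ≠ t → q ≠ t → p ∈ G.support → q ∈ G.support →
    ∃ W : G.Walk p q, t ∉ W.support

theorem Walk.mem_support_reverse {u v w : V} {p : G.Walk u v} :
    w ∈ p.reverse.support ↔ w ∈ p.support := by
  simp

theorem NoCutVertex.exists_ear (hG : G.NoCutVertex) {t y x : V} {S : Set V} (h : G.Adj t y)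
    (hx : x ∈ S) (hxt : x ≠ t) (hxs : x ∈ G.support) :
    ∃ t' ∈ S, t' ≠ t ∧ ∃ F : G.Walk t t', F.IsPath ∧ F.snd = y ∧
      ∀ w ∈ F.support, w ∈ S → w = t ∨ w = t' := by
  obtain ⟨W, hW⟩ := hG h.ne' hxt ⟨t, h.symm⟩ hxs
  obtain ⟨t', ht', F, hF, hFW, hFS⟩ := W.exists_isPath_inter_eq_end hx
  have htF : t ∉ F.support := fun h => hW (hFW t h)
  refine ⟨t', ht', fun e => htF (e ▸ F.end_mem_support), .cons h F, hF.cons htF, by simp, ?_⟩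
  grind [Walk.support_cons]

/-- In a multi-4-cycle graph, a path between two branches of a theta cannot start at the second
vertex of one branch and end inside another branch. -/
theorem not_crossing_theta (hG : Multi4 G) {s t s' t' : V} {h : G.Adj s t} {Q : G.Walk t s'}
    {R E : G.Walk s s'} {F : G.Walk t t'} (hss : s ≠ s') (hQ : (Walk.cons h Q).IsPath)
    (hR : R.IsPath) (hE : E.IsPath) (hF : F.IsPath) (hRE : R ≠ E)
    (hts : t ≠ s')
    (hQR' : ∀ w ∈ (Walk.cons h Q).support, w ∈ R.support → w = s ∨ w = s')
    (hQE' : ∀ w ∈ (Walk.cons h Q).support, w ∈ E.support → w = s ∨ w = s')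
    (hRE' : ∀ w ∈ R.support, w ∈ E.support → w = s ∨ w = s')
    (hFQ : ∀ w ∈ F.support, w ∈ (Walk.cons h Q).support → w = t ∨ w = t')
    (hFR : ∀ w ∈ F.support, w ∈ R.support → w = t ∨ w = t')
    (hFE : ∀ w ∈ F.support, w ∈ E.support → w = t ∨ w = t')
    (ht' : t' ∈ E.support) (hts' : t' ≠ s) (hts'' : t' ≠ s') : False := by
  classical
  have hsplit := E.take_spec ht'
  have hint : ∀ w ∈ (E.takeUntil t' ht').support, w ∈ (E.dropUntil t' ht').support → w = t' :=
    fun w => hE.eq_of_mem_takeUntil_of_mem_dropUntil ht'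
  have hE₁ := hE.takeUntil ht'
  have hE₂ := hE.dropUntil ht'
  have hs₁ := E.support_takeUntil_subset_support ht'
  have hs₂ := E.support_dropUntil_subset_support ht'
  have hlen : (E.takeUntil t' ht').length + (E.dropUntil t' ht').length = E.length := by
    rw [← Walk.length_append, Walk.take_spec]
  generalize E.takeUntil t' ht' = E₁ at *
  generalize E.dropUntil t' ht' = E₂ at *
  obtain ⟨hQ₀, hsQ⟩ := (Walk.cons_isPath_iff _ _).1 hQ
  have hst := h.ne
  have mQ : ∀ w, w ∈ (Walk.cons h Q).support ↔ w = s ∨ w ∈ Q.support := by simp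
  simp only [mQ] at hQR' hQE' hFQ
  have m1 := E.start_mem_support
  have m2 := E.end_mem_support
  have m3 := R.start_mem_support
  have m4 := R.end_mem_support
  have m5 := Q.start_mem_support
  have m6 := Q.end_mem_support
  have m7 := E₁.start_mem_support
  have m8 := E₂.end_mem_support
  have m9 := E₂.start_mem_support
  have m10 := F.start_mem_support
  have htE : t ∉ E.support := by grind
  have htR : t ∉ R.support := by grind
  have ht'Q : t' ∉ Q.support := by grind
  have ht'R : t' ∉ R.support := by grind
  have hsF : s ∉ F.support := by grind
  have hs'F : s' ∉ F.support := by grind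
  have hsE₂ : s ∉ E₂.support := by grind
  have hFE₂ : (F.append E₂).IsPath := hF.append_of_inter hE₂ (by grind)
  have c₁ := four_dvd_length_add_length hG (by grind) hF
    (hE₁.cons (h := h.symm) (by grind)) (fun e => hsF (by rw [e]; simp)) (by
      simp only [Walk.support_cons, List.mem_cons]; grind)
  have c₂ := four_dvd_length_add_length hG hss hR hE hRE hRE'
  have c₃ := four_dvd_length_add_length hG hss hR
    (hFE₂.cons (h := h) (by rw [Walk.mem_support_append_iff]; grind))
    (fun e => htR (by rw [e]; simp)) (by
      simp only [Walk.support_cons, List.mem_cons, Walk.mem_support_append_iff]; grind)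
  have c₄ := four_dvd_length_add_length hG hts hQ₀ hFE₂ (fun e => ht'Q (by rw [e]; simp)) (by
      simp only [Walk.mem_support_append_iff]; grind)
  have c₅ := four_dvd_length_add_length hG hss hQ hE (fun e => htE (by rw [← e]; simp)) (by
      simp only [mQ]; grind)
  simp only [Walk.length_cons, Walk.length_append] at c₁ c₂ c₃ c₄ c₅
  omega

/-- In a multi-4-cycle graph without cut vertices, every branch of a theta has an inner vertex of
degree two. -/
theorem NoCutVertex.false_of_theta (hcut : G.NoCutVertex) (hG : Multi4 G) (n : ℕ) :
    ∀ {s s' : V} {Q R E : G.Walk s s'}, Q.length = n → s ≠ s' → Q.IsPath → R.IsPath → E.IsPath →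
      Q ≠ R → Q ≠ E → R ≠ E →
      (∀ w ∈ Q.support, w ∈ R.support → w = s ∨ w = s') →
      (∀ w ∈ Q.support, w ∈ E.support → w = s ∨ w = s') →
      (∀ w ∈ R.support, w ∈ E.support → w = s ∨ w = s') →
      (∀ w ∈ Q.support, w ≠ s → w ≠ s' → ¬ ∃ p q, G.neighborSet w = {p, q}) → False := by
  classical
  induction n using Nat.strong_induction_on with | _ n ih
  intro s s' Q R E hn hss hQ hR hE hQR hQE hRE hQR' hQE' hRE' hdeg
  have d₁ := four_dvd_length_add_length hG hss hQ hR hQR hQR'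
  have d₂ := four_dvd_length_add_length hG hss hQ hE hQE hQE'
  have d₃ := four_dvd_length_add_length hG hss hR hE hRE hRE'
  cases Q with
  | nil => exact hss rfl
  | @cons _ t _ h Q =>
  cases Q with
  | nil => simp only [Walk.length_cons, Walk.length_nil] at d₁ d₂; omega
  | @cons _ t₂ _ h₂ Q =>
  obtain ⟨hQ₀, hsQ⟩ := (Walk.cons_isPath_iff _ _).1 hQ
  obtain ⟨hQ₁, htQ⟩ := (Walk.cons_isPath_iff _ _).1 hQ₀
  have hst := h.ne
  have hts' : t ≠ s' := fun e => htQ (e ▸ Q.end_mem_support)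
  obtain ⟨y, hy, hys, hyt₂⟩ : ∃ y, G.Adj t y ∧ y ≠ s ∧ y ≠ t₂ := by
    by_contra! hcon
    refine hdeg t (by simp) hst.symm hts' ⟨s, t₂, Set.ext fun y => ?_⟩
    simp only [mem_neighborSet, Set.mem_insert_iff, Set.mem_singleton_iff]
    constructor
    · intro hy
      by_cases hys : y = s
      · exact .inl hys
      · exact .inr (hcon y hy hys)
    · rintro (rfl | rfl)
      exacts [h.symm, h₂]
  have htR : t ∉ R.support := fun hm => by
    have := hQR' t (by simp) hm
    grind
  have htE : t ∉ E.support := fun hm => by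
    have := hQE' t (by simp) hm
    grind
  obtain ⟨t', ht', htt, F, hF, hFy, hFS⟩ := hcut.exists_ear (x := s)
    (S := {w | w ∈ (Walk.cons h (Walk.cons h₂ Q)).support ∨ w ∈ R.support ∨ w ∈ E.support}) hy
    (by simp) hst ⟨t, h⟩
  have hFQ : ∀ w ∈ F.support, w ∈ (Walk.cons h (Walk.cons h₂ Q)).support → w = t ∨ w = t' :=
    fun w hw hw' => hFS w hw (.inl hw')
  have hFR : ∀ w ∈ F.support, w ∈ R.support → w = t ∨ w = t' :=
    fun w hw hw' => hFS w hw (.inr (.inl hw'))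
  have hFE : ∀ w ∈ F.support, w ∈ E.support → w = t ∨ w = t' :=
    fun w hw hw' => hFS w hw (.inr (.inr hw'))
  by_cases hts : t' = s
  · subst hts
    have hp : ((Walk.cons h₂ Q).append R.reverse).IsPath :=
      hQ₀.append_of_inter hR.reverse (by
        intro w hw hw'
        rw [Walk.mem_support_reverse] at hw'
        rcases hQR' w (by rw [Walk.support_cons]; exact .tail _ hw) hw' with rfl | rfl
        · exact absurd hw hsQ
        · rfl)
    have c₁ := four_dvd_length_add_length hG htt.symm (p := .cons h.symm .nil) (q := F)
      (by simp [hst.symm]) hF (fun e => hys (by rw [← hFy, ← e]; simp)) (by simp)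
    have c₂ := four_dvd_length_add_length hG htt.symm hF hp
      (fun e => hyt₂ (by rw [← hFy, e]; simp)) (by
        intro w hw hw'
        rw [Walk.mem_support_append_iff, Walk.mem_support_reverse] at hw'
        rcases hw' with hw' | hw'
        · exact hFQ w hw (by rw [Walk.support_cons]; exact .tail _ hw')
        · exact hFR w hw hw')
    simp only [Walk.length_cons, Walk.length_append, Walk.length_nil, Walk.length_reverse] at *
    omega
  by_cases htQ' : t' ∈ (Walk.cons h₂ Q).support
  · have hlt := Walk.length_takeUntil_le_length _ htQ'
    have hsnd : ((Walk.cons h₂ Q).takeUntil t' htQ').snd = t₂ := by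
      rw [Walk.snd_takeUntil htt]; simp
    have hint : ∀ w ∈ ((Walk.cons h₂ Q).takeUntil t' htQ').support,
        w ∈ ((Walk.cons h₂ Q).dropUntil t' htQ').support → w = t' :=
      fun w => hQ₀.eq_of_mem_takeUntil_of_mem_dropUntil htQ'
    have hp₁ := hQ₀.takeUntil htQ'
    have hp₂ := hQ₀.dropUntil htQ'
    have hs₁ := Walk.support_takeUntil_subset_support _ htQ'
    have hs₂ := Walk.support_dropUntil_subset_support _ htQ'
    have mQ : ∀ w, w ∈ (Walk.cons h (Walk.cons h₂ Q)).support ↔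
      w = s ∨ w ∈ (Walk.cons h₂ Q).support := by simp
    have hm : t ∈ (Walk.cons h₂ Q).support := by simp
    have hs₂t : s ≠ t₂ := by rintro rfl; simp at hsQ
    simp only [mQ] at hQR' hQE' hFQ hdeg
    rw [Walk.length_cons] at hn
    generalize Walk.cons h₂ Q = Q₀ at *
    generalize Q₀.takeUntil t' htQ' = Q₁ at *
    generalize Q₀.dropUntil t' htQ' = Q₂ at *
    have m1 := Q₁.start_mem_support
    have m2 := Q₂.start_mem_support
    have m3 := Q₂.end_mem_support
    have hRQ : (R.append Q₂.reverse).IsPath := hR.append_of_inter hp₂.reverse (by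
      intro w hw hw'
      rw [Walk.mem_support_reverse] at hw'
      clear ih hdeg
      grind)
    have hR₁ : (Walk.cons h.symm (R.append Q₂.reverse)).IsPath := hRQ.cons (by
      rw [Walk.mem_support_append_iff, Walk.mem_support_reverse]
      clear ih hdeg
      grind)
    have mR : ∀ w, w ∈ (Walk.cons h.symm (R.append Q₂.reverse)).support ↔
      w = t ∨ w ∈ R.support ∨ w ∈ Q₂.support := by simp
    refine ih Q₁.length (by omega) rfl htt.symm hp₁ hR₁ hF ?_ ?_ ?_ ?_ ?_ ?_ ?_
    · intro e
      rw [e] at hsnd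
      simp [hs₂t] at hsnd
    · rintro rfl
      exact hyt₂ (hFy.symm.trans hsnd)
    · rintro rfl
      simp [hys.symm] at hFy
    · simp only [mR]
      clear ih hdeg
      grind
    · clear ih hdeg
      grind
    · simp only [mR]
      clear ih hdeg
      grind
    · intro w hw _ hwt'
      refine hdeg w (.inr (hs₁ hw)) ?_ ?_
      · rintro rfl
        exact hsQ (hs₁ hw)
      · rintro rfl
        exact hwt' (hint _ hw m3)
  · have mQ : ∀ w, w ∈ (Walk.cons h (Walk.cons h₂ Q)).support ↔
      w = s ∨ w ∈ (Walk.cons h₂ Q).support := by simp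
    have hts'' : t' ≠ s' := by
      rintro rfl
      exact htQ' (Walk.end_mem_support _)
    rcases ht' with ht' | ht' | ht'
    · rw [mQ] at ht'
      grind
    · exact not_crossing_theta hG hss hQ hE hR hF hRE.symm hts' hQE' hQR'
        (fun w h₁ h₂ => hRE' w h₂ h₁) hFQ hFE hFR ht' hts hts''
    · exact not_crossing_theta hG hss hQ hR hE hF hRE hts' hQR' hQE' hRE' hFQ hFR hFE ht' hts hts''

/-- In a multi-4-cycle graph without cut vertices, every cycle has a vertex of degree two other
than `v`. -/
theorem NoCutVertex.exists_neighborSet_eq_pair (hcut : G.NoCutVertex) (hG : Multi4 G) (v : V)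
    {u : V} {C : G.Walk u u} (hC : C.IsCycle) :
    ∃ w ∈ C.support, w ≠ v ∧ ∃ p q, G.neighborSet w = {p, q} := by
  classical
  by_contra! hcon
  obtain ⟨s, hs, hsv⟩ : ∃ s ∈ C.support, s ≠ v := by
    by_cases hu : u = v
    · exact ⟨C.snd, C.getVert_mem_support 1, fun e => (C.adj_snd hC.not_nil).ne (hu.trans e.symm)⟩
    · exact ⟨u, C.start_mem_support, hu⟩
  replace hcon : ∀ w ∈ (C.rotate s hs).support, w ≠ v → ∀ p q, G.neighborSet w ≠ {p, q} :=
    fun w hw => hcon w (by rwa [Walk.mem_support_rotate_iff] at hw)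
  replace hC := hC.rotate hs
  generalize C.rotate s hs = C at *
  cases C with
  | nil => exact hC.not_nil .nil
  | @cons _ y₁ _ h P =>
  obtain ⟨hP, hPe⟩ := (Walk.cons_isCycle_iff _ _).1 hC
  have hne : y₁ ≠ P.penultimate := by
    simpa [Walk.penultimate_cons_of_not_nil _ _ (Walk.not_nil_of_ne h.ne')]
      using hC.snd_ne_penultimate
  have hadj : G.Adj s P.penultimate := (P.adj_penultimate (Walk.not_nil_of_ne h.ne')).symm
  obtain ⟨y, hy, hyy₁, hyp⟩ : ∃ y, G.Adj s y ∧ y ≠ y₁ ∧ y ≠ P.penultimate := by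
    by_contra! hcon'
    refine hcon s (by simp) hsv y₁ P.penultimate (Set.ext fun y => ?_)
    simp only [mem_neighborSet, Set.mem_insert_iff, Set.mem_singleton_iff]
    constructor
    · intro hy
      by_cases hys : y = y₁
      · exact .inl hys
      · exact .inr (hcon' y hy hys)
    · rintro (rfl | rfl)
      exacts [h, hadj]
  obtain ⟨t, ht, hts, F, hF, hFy, hFS⟩ := hcut.exists_ear (x := y₁)
    (S := {w | w ∈ P.support}) hy P.start_mem_support h.ne' ⟨s, h.symm⟩
  have hsnd : (P.dropUntil t ht).reverse.snd = P.penultimate := by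
    conv_rhs => rw [← P.take_spec ht, ← Walk.snd_reverse, Walk.reverse_append]
    cases (P.dropUntil t ht).reverse with
    | nil => exact absurd rfl hts
    | cons h p => simp
  have hint : ∀ w ∈ (P.takeUntil t ht).support, w ∈ (P.dropUntil t ht).support → w = t :=
    fun w => hP.eq_of_mem_takeUntil_of_mem_dropUntil ht
  have hp₁ := hP.takeUntil ht
  have hp₂ := (hP.dropUntil ht).reverse
  have hs₁ := P.support_takeUntil_subset_support ht
  have hs₂ := P.support_dropUntil_subset_support ht
  have m₁ := (P.dropUntil t ht).end_mem_support
  have mP : ∀ w, w ∈ (Walk.cons h P).support ↔ w = s ∨ w ∈ P.support := by simp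
  simp only [mP] at hcon
  have mR : ∀ w, w ∈ (P.dropUntil t ht).reverse.support ↔ w ∈ (P.dropUntil t ht).support := by simp
  simp only [← mR] at hint m₁ hs₂
  have hs₂ : ∀ w ∈ (P.dropUntil t ht).reverse.support, w ∈ P.support :=
    fun w hw => P.support_dropUntil_subset_support ht ((mR w).1 hw)
  generalize P.takeUntil t ht = Q at *
  generalize (P.dropUntil t ht).reverse = R at *
  have hQ : (Walk.cons h Q).IsPath := hp₁.cons (by grind)
  have mQ : ∀ w, w ∈ (Walk.cons h Q).support ↔ w = s ∨ w ∈ Q.support := by simp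
  have hQs : (Walk.cons h Q).snd = y₁ := by simp
  have hQR : Walk.cons h Q ≠ R := fun e => hne (by rw [← hsnd, ← e, hQs])
  have hQF : Walk.cons h Q ≠ F := fun e => hyy₁ (by rw [← hFy, ← e, hQs])
  have hRF : R ≠ F := fun e => hyp (by rw [← hFy, ← e, hsnd])
  simp only [Set.mem_ofPred_eq] at hFS
  by_cases hv : v ∈ Q.support
  · refine hcut.false_of_theta hG _ rfl hts.symm hp₂ hQ hF hQR.symm hRF hQF ?_ ?_ ?_ ?_
    all_goals try simp only [mQ]
    all_goals grind
  · refine hcut.false_of_theta hG _ rfl hts.symm hQ hp₂ hF hQR hQF hRF ?_ ?_ ?_ ?_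
    all_goals try simp only [mQ]
    all_goals grind

/-- Two vertices are adjacent if they are the two neighbours of a vertex of `A` of degree two. -/
def linkGraph (G : SimpleGraph V) (A : Set V) : SimpleGraph V where
  Adj x y := x ≠ y ∧ ∃ w ∈ A, G.neighborSet w = {x, y}
  symm := ⟨fun _ _ h => ⟨h.1.symm, h.2.imp fun _ hw => ⟨hw.1, hw.2.trans (Set.pair_comm _ _)⟩⟩⟩
  loopless := ⟨fun _ h => h.1 rfl⟩

theorem exists_isPath_of_linkGraph (hbip : Bipartition G A) {x y : V}
    (P : (G.linkGraph A).Walk x y) (hP : P.IsPath) (hx : x ∉ A) :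
    ∃ Q : G.Walk x y, Q.IsPath ∧ Q.length = 2 * P.length ∧
      (∀ w ∈ Q.support, w ∉ A → w ∈ P.support) ∧
      ∀ w ∈ Q.support, w ∈ A → ∃ p q, s(p, q) ∈ P.edges ∧ G.neighborSet w = {p, q} := by
  induction P with
  | nil => exact ⟨.nil, .nil, by simp, by simp, by simp [hx]⟩
  | @cons x x₁ y h P ih =>
    obtain ⟨hxx, w, hw, hN⟩ := id h
    obtain ⟨hP', hxP⟩ := (Walk.cons_isPath_iff _ _).1 hP
    have hwx : G.Adj w x := by simp [← mem_neighborSet, hN]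
    have hwx₁ : G.Adj w x₁ := by simp [← mem_neighborSet, hN]
    obtain ⟨Q, hQ, hlen, hβ, hα⟩ := ih hP' ((hbip hwx₁).1 hw)
    have hwQ : w ∉ Q.support := fun hwQ => by
      obtain ⟨p, q, hpq, hN'⟩ := hα w hwQ hw
      have : x ∈ ({p, q} : Set V) := by rw [← hN', hN]; simp
      rcases this with rfl | rfl
      · exact hxP (P.fst_mem_support_of_mem_edges hpq)
      · exact hxP (P.snd_mem_support_of_mem_edges hpq)
    refine ⟨.cons hwx.symm (.cons hwx₁ Q), (hQ.cons hwQ).cons ?_, ?_, ?_, ?_⟩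
    · rw [Walk.support_cons, List.mem_cons, not_or]
      exact ⟨hwx.ne', fun hxQ => hxP (hβ x hxQ hx)⟩
    · simp only [Walk.length_cons]; omega
    · intro v hv hvA
      simp only [Walk.support_cons, List.mem_cons] at hv ⊢
      rcases hv with rfl | rfl | hv
      · exact .inl rfl
      · exact absurd hw hvA
      · exact .inr (hβ v hv hvA)
    · intro v hv hvA
      simp only [Walk.support_cons, List.mem_cons, Walk.edges_cons] at hv ⊢
      rcases hv with rfl | rfl | hv
      · exact absurd hvA hx
      · exact ⟨x, x₁, .inl rfl, hN⟩
      · obtain ⟨p, q, hpq, hN'⟩ := hα v hv hvA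
        exact ⟨p, q, .inr hpq, hN'⟩

theorem linkGraph_colorable_two (hG : Multi4 G) (hbip : Bipartition G A) :
    (G.linkGraph A).Colorable 2 := by
  refine colorable_two_of_even_cycles fun u C hC => ?_
  cases C with
  | nil => exact absurd .nil hC.not_nil
  | @cons x x₁ _ h P =>
    obtain ⟨hP, hPe⟩ := (Walk.cons_isCycle_iff _ _).1 hC
    obtain ⟨hxx, w, hw, hN⟩ := id h
    have hwx : G.Adj w u := by simp [← mem_neighborSet, hN]
    have hwx₁ : G.Adj w x₁ := by simp [← mem_neighborSet, hN]
    obtain ⟨Q, hQ, hlen, hβ, hα⟩ := exists_isPath_of_linkGraph hbip P hP ((hbip hwx₁).1 hw)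
    have hwQ : w ∉ Q.support := fun hwQ => by
      obtain ⟨p, q, hpq, hN'⟩ := hα w hwQ hw
      rw [hN', Set.pair_eq_pair_iff, ← Sym2.eq_iff] at hN
      exact hPe (hN ▸ hpq)
    have := four_dvd_length_add_length hG hxx.symm (p := .cons hwx₁.symm (.cons hwx .nil)) (q := Q)
      (by simp [hwx₁.ne', hwx.ne, hxx.symm]) hQ (fun e => hwQ (by simp [← e])) (by
        simp only [Walk.support_cons, Walk.support_nil, List.mem_cons]
        rintro v (rfl | rfl | rfl | hv) hvQ
        exacts [.inl rfl, absurd hvQ hwQ, .inr rfl, by simp at hv])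
    simp only [Walk.length_cons, Walk.length_nil] at this
    rw [Walk.length_cons, Nat.even_iff]
    omega

theorem Walk.IsCycle.exists_ne_adj {u w : V} {C : G.Walk u u} (hC : C.IsCycle)
    (hw : w ∈ C.support) :
    ∃ p ∈ C.support, ∃ q ∈ C.support, p ≠ q ∧ G.Adj w p ∧ G.Adj w q := by
  obtain ⟨p, q, hpq, hN⟩ := Set.ncard_eq_two.1 (hC.ncard_neighborSet_toSubgraph_eq_two hw)
  have hp : C.toSubgraph.Adj w p := by simp [← Subgraph.mem_neighborSet, hN]
  have hq : C.toSubgraph.Adj w q := by simp [← Subgraph.mem_neighborSet, hN]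
  exact ⟨p, C.mem_verts_toSubgraph.1 hp.snd_mem, q, C.mem_verts_toSubgraph.1 hq.snd_mem, hpq,
    hp.adj_sub, hq.adj_sub⟩

theorem Walk.IsCycle.mem_support_of_neighborSet_eq {u w p q : V} {C : G.Walk u u} (hC : C.IsCycle)
    (hw : w ∈ C.support) (hN : G.neighborSet w = {p, q}) :
    p ≠ q ∧ p ∈ C.support ∧ q ∈ C.support := by
  obtain ⟨p', hp', q', hq', hne, hwp, hwq⟩ := hC.exists_ne_adj hw
  rw [← mem_neighborSet, hN] at hwp hwq
  simp only [Set.mem_insert_iff, Set.mem_singleton_iff] at hwp hwq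
  rcases hwp with rfl | rfl <;> rcases hwq with rfl | rfl <;> grind

/-- No cycle is monochromatic, and the two neighbours of any vertex of `A` of degree two get
different colours. -/
structure IsGoodColouring (G : SimpleGraph V) (A : Set V) (f : V → Fin 2) : Prop where
  exists_ne : ∀ ⦃u : V⦄ ⦃C : G.Walk u u⦄, C.IsCycle → ∃ p ∈ C.support, ∃ q ∈ C.support, f p ≠ f q
  ne : ∀ ⦃w x y : V⦄, w ∈ A → x ≠ y → G.neighborSet w = {x, y} → f x ≠ f y

theorem IsGoodColouring.of_exists_mem (hG : Multi4 G) (hbip : Bipartition G A) {v : V} (hv : v ∉ A)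
    (a : V → Fin 2) (c : Fin 2)
    (h : ∀ ⦃u : V⦄ ⦃C : G.Walk u u⦄, C.IsCycle →
      ∃ w ∈ C.support, w ∈ A ∧ ∃ p q, G.neighborSet w = {p, q}) :
    ∃ f, G.IsGoodColouring A f ∧ (∀ w ∈ A, f w = a w) ∧ f v = c := by
  classical
  obtain ⟨g⟩ := linkGraph_colorable_two hG hbip
  have hne : ∀ ⦃w x y : V⦄, w ∈ A → x ≠ y → G.neighborSet w = {x, y} →
      A.piecewise a (fun x => g x - g v + c) x ≠ A.piecewise a (fun x => g x - g v + c) y := by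
    intro w x y hw hxy hN
    have hx : x ∉ A := (hbip (by simp [← mem_neighborSet, hN])).1 hw
    have hy : y ∉ A := (hbip (by simp [← mem_neighborSet, hN])).1 hw
    rw [Set.piecewise_eq_of_notMem _ _ _ hx, Set.piecewise_eq_of_notMem _ _ _ hy]
    have : g x ≠ g y := g.valid ⟨hxy, w, hw, hN⟩
    simpa using this
  refine ⟨A.piecewise a fun x => g x - g v + c, ⟨fun u C hC => ?_, hne⟩,
    fun w hw => Set.piecewise_eq_of_mem _ _ _ hw, by simp [hv]⟩
  obtain ⟨w, hwC, hw, p, q, hN⟩ := h hC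
  obtain ⟨hpq, hp, hq⟩ := hC.mem_support_of_neighborSet_eq hwC hN
  exact ⟨p, hp, q, hq, hne hw hpq hN⟩

theorem Multi4.mono (hG : Multi4 G) (h : H ≤ G) : Multi4 H := fun _ C hC => by
  simpa using hG (C.mapLe h) (hC.mapLe h)

theorem Bipartition.mono (hG : Bipartition G A) (h : H ≤ G) : Bipartition H A :=
  fun _ _ huw => hG (h huw)

/-- `G` is the union of two nonempty subgraphs that have at most the vertex `u` in common. -/
structure IsGluing (G H₁ H₂ : SimpleGraph V) (u : V) : Prop where
  sup_eq : H₁ ⊔ H₂ = G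
  left_ne_bot : H₁ ≠ ⊥
  right_ne_bot : H₂ ≠ ⊥
  eq_of_mem_support : ∀ ⦃p⦄, p ∈ H₁.support → p ∈ H₂.support → p = u

namespace IsGluing

variable {u : V}

theorem symm (h : G.IsGluing H₁ H₂ u) : G.IsGluing H₂ H₁ u :=
  ⟨sup_comm H₁ H₂ ▸ h.sup_eq, h.right_ne_bot, h.left_ne_bot,
    fun _ h₂ h₁ => h.eq_of_mem_support h₁ h₂⟩

theorem left_le (h : G.IsGluing H₁ H₂ u) : H₁ ≤ G := h.sup_eq ▸ le_sup_left

theorem right_le (h : G.IsGluing H₁ H₂ u) : H₂ ≤ G := h.symm.left_le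

theorem left_lt (h : G.IsGluing H₁ H₂ u) : H₁ < G := by
  refine h.left_le.lt_of_ne ?_
  rintro rfl
  obtain ⟨p, q, hpq⟩ := ne_bot_iff_exists_adj.1 h.right_ne_bot
  have hpq₁ := h.right_le hpq
  exact hpq.ne ((h.eq_of_mem_support ⟨q, hpq₁⟩ ⟨q, hpq⟩).trans
    (h.eq_of_mem_support ⟨p, hpq₁.symm⟩ ⟨p, hpq.symm⟩).symm)

theorem right_lt (h : G.IsGluing H₁ H₂ u) : H₂ < G := h.symm.left_lt

theorem adj_or_adj (h : G.IsGluing H₁ H₂ u) {p q : V} (hpq : G.Adj p q) :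
    H₁.Adj p q ∨ H₂.Adj p q := by
  rwa [← h.sup_eq] at hpq

theorem adj_iff_left (h : G.IsGluing H₁ H₂ u) {p q : V} (hp : p ∈ H₁.support) (hpu : p ≠ u) :
    G.Adj p q ↔ H₁.Adj p q := by
  exact ⟨fun hpq => (h.adj_or_adj hpq).resolve_right fun hpq =>
    hpu (h.eq_of_mem_support hp ⟨q, hpq⟩), fun hpq => h.left_le hpq⟩

theorem adj_left_of_mem_edges (h : G.IsGluing H₁ H₂ u) {x y : V} (W : G.Walk x y)
    (hx : x ∈ H₁.support) (hxu : x ≠ u) (hW : u ∉ W.support ∨ y = u ∧ W.IsPath) :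
    ∀ e ∈ W.edges, e ∈ H₁.edgeSet := by
  induction W with
  | nil => simp
  | @cons x x₁ y hxx W ih =>
    have hxx₁ := (h.adj_iff_left hx hxu).1 hxx
    simp only [Walk.edges_cons, List.forall_mem_cons, mem_edgeSet]
    refine ⟨hxx₁, ?_⟩
    by_cases hx₁ : x₁ = u
    · subst hx₁
      rcases hW with hW | ⟨rfl, hW⟩
      · simp at hW
      · simp [(Walk.isPath_iff_nil.1 hW.of_cons).eq_nil]
    · refine ih ⟨x, hxx₁.symm⟩ hx₁ (hW.imp (fun hW hu => hW (by simp [hu])) fun hW => ?_)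
      exact ⟨hW.1, hW.2.of_cons⟩

theorem edges_subset_left_of_snd (h : G.IsGluing H₁ H₂ u) {C : G.Walk u u} (hC : C.IsCycle)
    (hs : H₁.Adj u C.snd) : ∀ e ∈ C.edges, e ∈ H₁.edgeSet := by
  cases C with
  | nil => simp
  | @cons _ x _ hux W =>
    simp only [Walk.snd_cons] at hs
    simp only [Walk.edges_cons, List.forall_mem_cons, mem_edgeSet]
    exact ⟨hs, h.adj_left_of_mem_edges W ⟨u, hs.symm⟩ hs.ne'
      (.inr ⟨rfl, ((Walk.cons_isCycle_iff _ _).1 hC).1⟩)⟩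

theorem edges_subset (h : G.IsGluing H₁ H₂ u) {x : V} {C : G.Walk x x} (hC : C.IsCycle) :
    (∀ e ∈ C.edges, e ∈ H₁.edgeSet) ∨ ∀ e ∈ C.edges, e ∈ H₂.edgeSet := by
  classical
  by_cases hu : u ∈ C.support
  · have hC' := hC.rotate hu
    have hmem : ∀ e, e ∈ C.edges ↔ e ∈ (C.rotate u hu).edges :=
      fun e => (C.rotate_edges u hu).mem_iff.symm
    simp only [hmem]
    have hs := h.adj_or_adj ((C.rotate u hu).adj_snd hC'.not_nil)
    exact hs.imp (h.edges_subset_left_of_snd hC') (h.symm.edges_subset_left_of_snd hC')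
  · have hxu : x ≠ u := fun hxu => hu (hxu ▸ C.start_mem_support)
    have hs := h.adj_or_adj (C.adj_snd hC.not_nil)
    exact hs.imp (fun hs => h.adj_left_of_mem_edges C ⟨_, hs⟩ hxu (.inl hu))
      (fun hs => h.symm.adj_left_of_mem_edges C ⟨_, hs⟩ hxu (.inl hu))

end IsGluing

theorem IsGoodColouring.exists_ne_of_forall_mem_edges {f g : V → Fin 2}
    (hf : H.IsGoodColouring A f) {u : V} {C : G.Walk u u} (hC : C.IsCycle)
    (hCH : ∀ e ∈ C.edges, e ∈ H.edgeSet) (hfg : ∀ p ∈ C.support, p ∈ H.support → g p = f p) :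
    ∃ p ∈ C.support, ∃ q ∈ C.support, g p ≠ g q := by
  have hC' := hC.transfer hCH
  obtain ⟨p, hp, q, hq, hpq⟩ := hf.exists_ne hC'
  have hmem : ∀ r ∈ (C.transfer H hCH).support, r ∈ C.support ∧ g r = f r := fun r hr => by
    have hrC : r ∈ C.support := by simpa using hr
    obtain ⟨s, -, -, -, -, hrs, -⟩ := hC'.exists_ne_adj hr
    exact ⟨hrC, hfg r hrC ⟨s, hrs⟩⟩
  refine ⟨p, (hmem p hp).1, q, (hmem q hq).1, ?_⟩
  rwa [(hmem p hp).2, (hmem q hq).2]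

/-- Every vertex outside `A` can be prescribed its colour in some good colouring of `G`. -/
def Extendable (G : SimpleGraph V) (A : Set V) (a : V → Fin 2) : Prop :=
  ∀ v ∉ A, ∀ c, ∃ f, G.IsGoodColouring A f ∧ (∀ w ∈ A, f w = a w) ∧ f v = c

theorem fin_two_add_one_ne (i : Fin 2) : i + 1 ≠ i := by
  revert i; decide

namespace IsGluing

variable {u : V} {a : V → Fin 2}

theorem isGoodColouring (h : G.IsGluing H₁ H₂ u) {f f₁ f₂ : V → Fin 2}
    (h₁ : H₁.IsGoodColouring A f₁) (h₂ : H₂.IsGoodColouring A f₂)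
    (hf₁ : ∀ p ∈ H₁.support, f p = f₁ p) (hf₂ : ∀ p ∈ H₂.support, f p = f₂ p)
    (hu : ∀ ⦃x y⦄, u ∈ A → H₁.Adj u x → H₂.Adj u y → G.neighborSet u = {x, y} → f x ≠ f y) :
    G.IsGoodColouring A f where
  exists_ne x C hC := (h.edges_subset hC).elim
    (fun hC' => h₁.exists_ne_of_forall_mem_edges hC hC' fun p _ => hf₁ p)
    (fun hC' => h₂.exists_ne_of_forall_mem_edges hC hC' fun p _ => hf₂ p)
  ne w x y hw hxy hN := by
    have hwx : G.Adj w x := by simp [← mem_neighborSet, hN]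
    have hwy : G.Adj w y := by simp [← mem_neighborSet, hN]
    have key : ∀ {K₁ K₂ : SimpleGraph V} {g : V → Fin 2}, G.IsGluing K₁ K₂ u →
        K₁.IsGoodColouring A g → (∀ p ∈ K₁.support, f p = g p) → K₁.Adj w x → K₁.Adj w y →
        f x ≠ f y := by
      intro K₁ K₂ g hK hg hfg hwx hwy
      rw [hfg x ⟨w, hwx.symm⟩, hfg y ⟨w, hwy.symm⟩]
      refine hg.ne hw hxy (Set.Subset.antisymm ?_ ?_)
      · exact hN ▸ fun p hp => hK.left_le hp
      · rintro p (rfl | rfl)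
        exacts [hwx, hwy]
    rcases h.adj_or_adj hwx with hx | hx <;> rcases h.adj_or_adj hwy with hy | hy
    · exact key h h₁ hf₁ hx hy
    · obtain rfl := h.eq_of_mem_support ⟨x, hx⟩ ⟨y, hy⟩
      exact hu hw hx hy hN
    · obtain rfl := h.eq_of_mem_support ⟨y, hy⟩ ⟨x, hx⟩
      exact (hu hw hy hx (hN.trans (Set.pair_comm _ _))).symm
    · exact key h.symm h₂ hf₂ hx hy

theorem exists_isGoodColouring (h : G.IsGluing H₁ H₂ u) (hbip : Bipartition G A)
    (h₁ : H₁.Extendable A a) (h₂ : H₂.Extendable A a) {v : V} (hv : v ∉ A)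
    (hvH : v ∈ H₂.support → v = u) (c : Fin 2) :
    ∃ f, G.IsGoodColouring A f ∧ (∀ w ∈ A, f w = a w) ∧ f v = c := by
  classical
  obtain ⟨f₁, hf₁, ha₁, rfl⟩ := h₁ v hv c
  obtain ⟨f₂, hf₂, ha₂, huf, hne⟩ : ∃ f₂, H₂.IsGoodColouring A f₂ ∧ (∀ w ∈ A, f₂ w = a w) ∧
      f₂ u = f₁ u ∧
      ∀ ⦃x y⦄, u ∈ A → H₁.Adj u x → H₂.Adj u y → G.neighborSet u = {x, y} → f₁ x ≠ f₂ y := by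
    by_cases hu : u ∈ A
    · by_cases hN : ∃ x y, H₁.Adj u x ∧ H₂.Adj u y ∧ G.neighborSet u = {x, y}
      · obtain ⟨x, y, hx, hy, hN⟩ := hN
        obtain ⟨f₂, hf₂, ha₂, hy₂⟩ := h₂ y ((hbip (h.right_le hy)).1 hu) (f₁ x + 1)
        refine ⟨f₂, hf₂, ha₂, by rw [ha₁ u hu, ha₂ u hu], fun x' y' _ hx' hy' hN' => ?_⟩
        have hxy : ¬ H₂.Adj u x' := fun hx₂ => hx'.ne' (h.eq_of_mem_support ⟨u, hx'.symm⟩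
          ⟨u, hx₂.symm⟩)
        have hyx : ¬ H₁.Adj u y' := fun hy₁ => hy'.ne' (h.eq_of_mem_support ⟨u, hy₁.symm⟩
          ⟨u, hy'.symm⟩)
        rw [hN, Set.pair_eq_pair_iff] at hN'
        rcases hN' with ⟨rfl, rfl⟩ | ⟨rfl, rfl⟩
        · rw [hy₂]
          exact (fin_two_add_one_ne _).symm
        · exact absurd hx hyx
      · obtain ⟨f₂, hf₂, ha₂, -⟩ := h₂ v hv 0
        exact ⟨f₂, hf₂, ha₂, by rw [ha₁ u hu, ha₂ u hu],
          fun x y _ hx hy hxy => absurd ⟨x, y, hx, hy, hxy⟩ hN⟩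
    · obtain ⟨f₂, hf₂, ha₂, huf⟩ := h₂ u hu (f₁ u)
      exact ⟨f₂, hf₂, ha₂, huf, fun _ _ hu' => absurd hu' hu⟩
  set f : V → Fin 2 := fun p => if p ∈ H₂.support then f₂ p else f₁ p with hf
  have hfH₂ : ∀ p ∈ H₂.support, f p = f₂ p := fun p hp => if_pos hp
  have hfH₁ : ∀ p ∈ H₁.support, f p = f₁ p := fun p hp => by
    by_cases hp₂ : p ∈ H₂.support
    · obtain rfl := h.eq_of_mem_support hp hp₂
      rw [hfH₂ p hp₂, huf]
    · exact if_neg hp₂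
  refine ⟨f, h.isGoodColouring hf₁ hf₂ hfH₁ hfH₂ fun x y hu hx hy hN => ?_, fun w hw => ?_, ?_⟩
  · rw [hfH₁ x ⟨u, hx.symm⟩, hfH₂ y ⟨u, hy.symm⟩]
    exact hne hu hx hy hN
  · simp [hf, ha₁ w hw, ha₂ w hw]
  · by_cases hv₂ : v ∈ H₂.support
    · rw [hfH₂ v hv₂, hvH hv₂, huf]
    · exact if_neg hv₂

theorem extendable (h : G.IsGluing H₁ H₂ u) (hbip : Bipartition G A)
    (h₁ : H₁.Extendable A a) (h₂ : H₂.Extendable A a) : G.Extendable A a := by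
  intro v hv c
  by_cases hv₂ : v ∈ H₂.support → v = u
  · exact h.exists_isGoodColouring hbip h₁ h₂ hv hv₂ c
  · refine h.symm.exists_isGoodColouring hbip h₂ h₁ hv (fun hv₁ => ?_) c
    push Not at hv₂
    exact h.eq_of_mem_support hv₁ hv₂.1

end IsGluing

theorem noCutVertex_of_not_isGluing (h : ∀ H₁ H₂ u, ¬ G.IsGluing H₁ H₂ u) : G.NoCutVertex := by
  intro t p q hpt hqt hp hq
  by_contra hpq
  set S : Set V := {r | ∃ W : G.Walk p r, t ∉ W.support} with hS
  have hpS : p ∈ S := ⟨.nil, by simpa using hpt.symm⟩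
  have htS : t ∉ S := fun ⟨W, hW⟩ => hW W.end_mem_support
  have hstep : ∀ ⦃r s⦄, r ∈ S → G.Adj r s → s ≠ t → s ∈ S := by
    rintro r s ⟨W, hW⟩ hrs hst
    exact ⟨W.concat hrs, by simp [Walk.support_concat, hW, hst.symm]⟩
  let H₁ : SimpleGraph V :=
    { Adj := fun r s => G.Adj r s ∧ (r ∈ S ∨ s ∈ S)
      symm := ⟨fun _ _ h => ⟨h.1.symm, h.2.symm⟩⟩
      loopless := ⟨fun _ h => h.1.ne rfl⟩ }
  let H₂ : SimpleGraph V :=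
    { Adj := fun r s => G.Adj r s ∧ ¬ (r ∈ S ∨ s ∈ S)
      symm := ⟨fun _ _ h => ⟨h.1.symm, fun h' => h.2 h'.symm⟩⟩
      loopless := ⟨fun _ h => h.1.ne rfl⟩ }
  refine h H₁ H₂ t ⟨?_, ?_, ?_, ?_⟩
  · ext r s
    change (G.Adj r s ∧ _) ∨ (G.Adj r s ∧ ¬ _) ↔ _
    tauto
  · obtain ⟨r, hr⟩ := hp
    exact ne_bot_iff_exists_adj.2 ⟨p, r, hr, .inl hpS⟩
  · obtain ⟨r, hr⟩ := hq
    exact ne_bot_iff_exists_adj.2 ⟨q, r, hr, fun hS => hS.elim hpq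
      fun hrS => hpq (hstep hrS hr.symm hqt)⟩
  · rintro r ⟨s, hrs, hS₁⟩ ⟨s', hrs', hS₂⟩
    by_contra hrt
    exact hS₂ (.inl (hS₁.elim id fun hs => hstep hs hrs.symm hrt))

theorem IsGoodColouring.exists_update [DecidableEq V] {f : V → Fin 2}
    {x y z : V} (hf : (G.deleteIncidenceSet z).IsGoodColouring A f) (hz : z ∉ A)
    (hN : G.neighborSet z = {x, y}) (hy : ¬ ∃ p q, G.neighborSet y = {p, q}) :
    ∃ i, G.IsGoodColouring A (Function.update f z i) := by
  have hzx : G.Adj z x := by simp [← mem_neighborSet, hN]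
  obtain ⟨i, hiN, hiC⟩ : ∃ i, (∀ x', x' ≠ z → G.neighborSet x = {z, x'} → i ≠ f x') ∧
      ∀ ⦃u⦄ ⦃C : G.Walk u u⦄, C.IsCycle → z ∈ C.support → ∃ p ∈ C.support, p ≠ z ∧ i ≠ f p := by
    by_cases hx : ∃ x', x' ≠ z ∧ G.neighborSet x = {z, x'}
    · obtain ⟨x', hx'z, hx⟩ := hx
      refine ⟨f x' + 1, fun x'' hx'' hN' => ?_, fun u C hC hzC => ?_⟩
      · have : x'' ∈ ({z, x'} : Set V) := by rw [← hx, hN']; simp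
        obtain rfl := this.resolve_left hx''
        exact fin_two_add_one_ne _
      · have hxC := (hC.mem_support_of_neighborSet_eq hzC hN).2.1
        exact ⟨x', (hC.mem_support_of_neighborSet_eq hxC hx).2.2, hx'z, fin_two_add_one_ne _⟩
    · refine ⟨f x + 1, fun x' hx' hN' => absurd ⟨x', hx', hN'⟩ hx, fun u C hC hzC => ?_⟩
      exact ⟨x, (hC.mem_support_of_neighborSet_eq hzC hN).2.1, hzx.ne', fin_two_add_one_ne _⟩
  refine ⟨i, fun u C hC => ?_, fun w p q hw hpq hNw => ?_⟩
  · by_cases hzC : z ∈ C.support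
    · obtain ⟨p, hp, hpz, hip⟩ := hiC hC hzC
      exact ⟨z, hzC, p, hp, by rwa [Function.update_self, Function.update_of_ne hpz]⟩
    · have hne : ∀ p ∈ C.support, p ≠ z := fun p hp hpz => hzC (hpz ▸ hp)
      refine hf.exists_ne_of_forall_mem_edges hC (fun e he => ?_) fun p hp _ =>
        Function.update_of_ne (hne p hp) _ _
      induction e with
      | h p q =>
        exact (G.deleteIncidenceSet_adj).2 ⟨C.adj_of_mem_edges he,
          hne p (C.fst_mem_support_of_mem_edges he), hne q (C.snd_mem_support_of_mem_edges he)⟩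
  · have hwz : w ≠ z := fun h => hz (h ▸ hw)
    by_cases hzw : G.Adj z w
    · rw [← mem_neighborSet, hN] at hzw
      obtain rfl : w = x := hzw.resolve_right fun h => hy ⟨p, q, h ▸ hNw⟩
      have hz' : z ∈ ({p, q} : Set V) := hNw ▸ hzx.symm
      rcases hz' with rfl | rfl
      · rw [Function.update_self, Function.update_of_ne hpq.symm]
        exact hiN q hpq.symm hNw
      · rw [Function.update_self, Function.update_of_ne hpq]
        exact (hiN p hpq (hNw.trans (Set.pair_comm _ _))).symm
    · have hne : ∀ r ∈ G.neighborSet w, r ≠ z := fun r hr hrz => hzw (hrz ▸ hr).symm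
      rw [Function.update_of_ne (hne p (by simp [hNw])),
        Function.update_of_ne (hne q (by simp [hNw]))]
      refine hf.ne hw hpq (hNw ▸ Set.ext fun r => ?_)
      simp only [mem_neighborSet, deleteIncidenceSet_adj]
      exact ⟨fun h => h.1, fun h => ⟨h, hwz, hne r h⟩⟩

theorem extendable_of_multi4 [Finite V] (hG : Multi4 G) (hbip : Bipartition G A) (a : V → Fin 2) :
    G.Extendable A a := by
  classical
  induction G using WellFoundedLT.induction with
  | ind G ih =>
  by_cases hglue : ∃ H₁ H₂ u, G.IsGluing H₁ H₂ u
  · obtain ⟨H₁, H₂, u, h⟩ := hglue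
    exact h.extendable hbip (ih H₁ h.left_lt (hG.mono h.left_le) (hbip.mono h.left_le))
      (ih H₂ h.right_lt (hG.mono h.right_le) (hbip.mono h.right_le))
  push Not at hglue
  have hcut := noCutVertex_of_not_isGluing hglue
  intro v hv c
  by_cases hz : ∃ z x y, z ∉ A ∧ z ≠ v ∧ G.neighborSet z = {x, y} ∧
    ¬ ∃ p q, G.neighborSet y = {p, q}
  · obtain ⟨z, x, y, hzA, hzv, hN, hy⟩ := hz
    have hle : G.deleteIncidenceSet z ≤ G := G.deleteIncidenceSet_le z
    have hzx : G.Adj z x := by simp [← mem_neighborSet, hN]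
    have hlt : G.deleteIncidenceSet z < G := hle.lt_of_ne fun he => by
      rw [← he, deleteIncidenceSet_adj] at hzx
      exact hzx.2.1 rfl
    obtain ⟨f, hf, ha, hfv⟩ := ih _ hlt (hG.mono hle) (hbip.mono hle) v hv c
    obtain ⟨i, hi⟩ := hf.exists_update hzA hN hy
    refine ⟨_, hi, fun w hw => ?_, ?_⟩
    · rw [Function.update_of_ne (by grind), ha w hw]
    · rw [Function.update_of_ne hzv.symm, hfv]
  · refine IsGoodColouring.of_exists_mem hG hbip hv a c fun u C hC => ?_
    obtain ⟨w, hwC, hwv, p, q, hN⟩ := hcut.exists_neighborSet_eq_pair hG v hC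
    by_cases hw : w ∈ A
    · exact ⟨w, hwC, hw, p, q, hN⟩
    · obtain ⟨-, hp, hq⟩ := hC.mem_support_of_neighborSet_eq hwC hN
      have hwq : G.Adj w q := by simp [← mem_neighborSet, hN]
      refine ⟨q, hq, by simpa using mt (hbip hwq).2 hw, ?_⟩
      by_contra h
      exact hz ⟨w, p, q, hw, hwv, hN, h⟩

end SimpleGraph

/-- Theorem 2.2.  Let `G` have multi-4-cycles, with bipartition
`{A, Aᶜ}`.  For every `v ∉ A`, every 2-colouring `a` of `A`, and every prescribed
colour `c`, there is a 2-colouring of the type-β vertices — encoded as a total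
colouring `f` agreeing with `a` on `A` — such that: (1) no cycle of `G` is
monochromatic; (2) along every path with both endpoints of type β and all inner
vertices of degree 2 in `G`, the type-β vertices are coloured alternately; and
(3) `f v = c`. -/
theorem exists_good_beta_colouring {V : Type*} [Fintype V] [DecidableEq V]
    (G : SimpleGraph V) [DecidableRel G.Adj] (A : Set V)
    (hG : Multi4 G) (hbip : Bipartition G A)
    (v : V) (hv : v ∉ A) (a : V → Fin 2) (c : Fin 2) :
    ∃ f : V → Fin 2, (∀ w ∈ A, f w = a w) ∧
      (∀ (u : V) (cy : G.Walk u u), cy.IsCycle →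
        ¬ (∀ p ∈ cy.support, ∀ q ∈ cy.support, f p = f q)) ∧
      (∀ (p q : V) (P : G.Walk p q), P.IsPath → p ∉ A → q ∉ A →
        (∀ w ∈ innSet P, G.degree w = 2) →
        ∀ i : ℕ, i + 2 ≤ P.length → P.getVert i ∉ A →
          f (P.getVert i) ≠ f (P.getVert (i + 2))) ∧
      f v = c := by
  obtain ⟨f, hf, ha, hfv⟩ := SimpleGraph.extendable_of_multi4 hG hbip a v hv c
  refine ⟨f, ha, fun u C hC h => ?_, fun p q P hP hp hq hdeg i hi hiA => ?_, hfv⟩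
  · obtain ⟨p, hp, q, hq, hpq⟩ := hf.exists_ne hC
    exact hpq (h p hp q hq)
  · have h₀ := P.adj_getVert_succ (i := i) (by omega)
    have h₁ := P.adj_getVert_succ (i := i + 1) (by omega)
    have hw : P.getVert (i + 1) ∈ A := (hbip h₀.symm).2 hiA
    have hne : P.getVert i ≠ P.getVert (i + 2) := fun h => by
      have := hP.getVert_injOn (show i ∈ {j | j ≤ P.length} by simp; omega)
        (show i + 2 ∈ {j | j ≤ P.length} from hi) h
      omega
    refine hf.ne hw hne ?_
    have hcard := hdeg (P.getVert (i + 1)) ⟨P.getVert_mem_support _, fun h => hp (h ▸ hw),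
      fun h => hq (h ▸ hw)⟩
    rw [← card_neighborFinset_eq_degree] at hcard
    have := Finset.eq_of_subset_of_card_le
      (s := {P.getVert i, P.getVert (i + 2)}) (t := G.neighborFinset (P.getVert (i + 1)))
      (by simp [Finset.insert_subset_iff, h₀.symm, h₁]) (by rw [hcard, Finset.card_pair hne])
    rw [← coe_neighborFinset, ← this, Finset.coe_pair]
end

section
/- Let G be a simple graph in which every cycle has length divisible by 4, with vertex bipartition {V_α, V_β}; fix a vertex v ∈ V_β, a 2-colouring a : V_α → {1, 2}, and a prescribed colour c ∈ {1, 2}. If K is a connected subgraph of G such that every vertex of degree at least 3 in K is of type β, then there exists a 2-colouring k of the type-β vertices of K with values in {1, 2} such that: (a) no cycle of K is monochromatic with respect to the colouring combining a and k; (b) for every path in K whose two endpoints are of type β, the type-β vertices along that path are coloured 1 and 2 alternately by k; and (c) if v is a vertex of K, then k(v) = c. -/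
open SimpleGraph

theorem length_eq_one_of_isPath_of_mem_edges {V : Type*} {H : SimpleGraph V} {u w : V}
    {P : H.Walk w u} (hP : P.IsPath) (he : s(u, w) ∈ P.edges) : P.length = 1 := by
  cases P with
  | nil => simp at he
  | @cons _ r _ h Q =>
    rw [Walk.cons_isPath_iff] at hP
    rw [Walk.edges_cons, List.mem_cons] at he
    rcases he with he | he
    · obtain rfl : u = r := by
        rcases Sym2.eq_iff.1 he with ⟨rfl, rfl⟩ | ⟨h', -⟩
        · rfl
        · exact h'
      simp [(Walk.isPath_iff_nil.1 hP.1).length_eq_zero]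
    · exact absurd (Q.snd_mem_support_of_mem_edges he) hP.2

theorem exists_isPath_length_mod_two_eq {V : Type*} {H : SimpleGraph V}
    (hH : ∀ (u : V) (C : H.Walk u u), C.IsCycle → Even C.length) {u w : V} (W : H.Walk u w) :
    ∃ Q : H.Walk u w, Q.IsPath ∧ Q.length % 2 = W.length % 2 := by
  classical
  induction W with
  | nil => exact ⟨.nil, by simp, rfl⟩
  | @cons u r w h W ih =>
    obtain ⟨Q, hQ, hlen⟩ := ih
    by_cases hu : u ∈ Q.support
    · refine ⟨Q.dropUntil u hu, hQ.dropUntil hu, ?_⟩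
      have hadd : (Q.takeUntil u hu).length + (Q.dropUntil u hu).length = Q.length := by
        rw [← Walk.length_append, Walk.take_spec]
      have hT : (Q.takeUntil u hu).IsPath := hQ.takeUntil hu
      have hodd : (Q.takeUntil u hu).length % 2 = 1 := by
        by_cases he : s(u, r) ∈ (Q.takeUntil u hu).edges
        · rw [length_eq_one_of_isPath_of_mem_edges hT he]
        · have := hH _ (Walk.cons h (Q.takeUntil u hu)) ((Walk.cons_isCycle_iff _ _).2 ⟨hT, he⟩)
          rw [Walk.length_cons, Nat.even_iff] at this
          omega
      rw [Walk.length_cons]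
      omega
    · refine ⟨.cons h Q, (Walk.cons_isPath_iff _ _).2 ⟨hQ, hu⟩, ?_⟩
      simp only [Walk.length_cons]
      omega

theorem colorable_two_of_forall_isCycle_even {V : Type*} {H : SimpleGraph V}
    (hH : ∀ (u : V) (C : H.Walk u u), C.IsCycle → Even C.length) : H.Colorable 2 := by
  refine two_colorable_iff_forall_loop_even.2 fun u W => ?_
  obtain ⟨Q, hQ, hlen⟩ := exists_isPath_length_mod_two_eq hH W
  rw [Nat.even_iff, ← hlen, (Walk.isPath_iff_nil.1 hQ).length_eq_zero]

/-- The graph on the vertices outside `A` that joins two of them when they are distinct and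
have a common neighbour in `K`. -/
def commonNeighborGraph {V : Type*} (K : SimpleGraph V) (A : Set V) : SimpleGraph V where
  Adj p q := p ≠ q ∧ p ∉ A ∧ q ∉ A ∧ ∃ x, K.Adj p x ∧ K.Adj x q
  symm := ⟨fun _ _ ⟨h, hp, hq, x, hpx, hxq⟩ => ⟨h.symm, hq, hp, x, hxq.symm, hpx.symm⟩⟩
  loopless := ⟨fun _ h => h.1 rfl⟩

theorem eq_or_eq_of_adj_of_not_three_le_ncard {V : Type*} [Finite V] {K : SimpleGraph V}
    {x p q r : V} (hx : ¬ 3 ≤ (K.neighborSet x).ncard) (hpq : p ≠ q)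
    (hp : K.Adj x p) (hq : K.Adj x q) (hr : K.Adj x r) : r = p ∨ r = q := by
  by_contra! h
  have hsub : ({p, q, r} : Set V) ⊆ K.neighborSet x := by
    rintro y (rfl | rfl | rfl) <;> assumption
  have hcard : ({p, q, r} : Set V).ncard = 3 :=
    Set.ncard_eq_three.2 ⟨p, q, r, hpq, h.1.symm, h.2.symm, rfl⟩
  exact hx (hcard ▸ Set.ncard_le_ncard hsub (Set.toFinite _))

/-- A walk in `commonNeighborGraph K A` lifts to a walk in `K` of twice the length, and paths
lift to paths when the vertices in `A` have degree at most two. -/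
theorem exists_lift_walk_of_commonNeighborGraph {V : Type*} [Finite V] {K : SimpleGraph V}
    {A : Set V} (hbip : Bipartition K A)
    (hdeg : ∀ u : V, 3 ≤ (K.neighborSet u).ncard → u ∉ A) {p q : V}
    (W : (commonNeighborGraph K A).Walk p q) :
    ∃ L : K.Walk p q, L.length = 2 * W.length ∧
      (∀ x ∈ L.support, x ∉ A → x ∈ W.support) ∧
      (∀ x ∈ L.support, x ∈ A → p ∉ A → ∃ u w, s(u, w) ∈ W.edges ∧ K.Adj x u ∧ K.Adj x w) ∧
      (W.IsPath → L.IsPath) := by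
  induction W with
  | nil => exact ⟨.nil, by simp, by simp, by simp +contextual, by simp⟩
  | @cons p r q h W ih =>
    obtain ⟨L, hlen, hβ, hα, hpath⟩ := ih
    obtain ⟨hpr, hpA, hrA, x, hpx, hxr⟩ := id h
    have hxA : x ∈ A := by have := hbip hpx; tauto
    refine ⟨.cons hpx (.cons hxr L), by simp [hlen]; omega, ?_, ?_, ?_⟩
    · intro y hy hyA
      simp only [Walk.support_cons, List.mem_cons] at hy ⊢
      rcases hy with rfl | rfl | hy
      · exact .inl rfl
      · exact absurd hxA hyA
      · exact .inr (hβ y hy hyA)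
    · intro y hy hyA _
      simp only [Walk.support_cons, List.mem_cons] at hy
      rcases hy with rfl | rfl | hy
      · exact absurd hyA hpA
      · exact ⟨p, r, by simp, hpx.symm, hxr⟩
      · obtain ⟨u, w, he, hu, hw⟩ := hα y hy hyA hrA
        exact ⟨u, w, by simp [he], hu, hw⟩
    · intro hW
      rw [Walk.cons_isPath_iff] at hW
      have hpL : p ∉ L.support := fun hp => hW.2 (hβ p hp hpA)
      rw [Walk.cons_isPath_iff, Walk.cons_isPath_iff]
      refine ⟨⟨hpath hW.1, fun hx => ?_⟩, ?_⟩
      · obtain ⟨u, w, he, hu, hw⟩ := hα x hx hxA hrA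
        have huw : u ≠ w := (W.adj_of_mem_edges he).ne
        rcases eq_or_eq_of_adj_of_not_three_le_ncard (fun h3 => hdeg x h3 hxA) huw hu hw hpx.symm
          with rfl | rfl
        · exact hW.2 (W.fst_mem_support_of_mem_edges he)
        · exact hW.2 (W.snd_mem_support_of_mem_edges he)
      · simp only [Walk.support_cons, List.mem_cons, not_or]
        exact ⟨hpx.ne, hpL⟩

/-- If every cycle of `K` has length divisible by four and the vertices in `A` have degree at most
two, then all cycles of `commonNeighborGraph K A` are even. -/
theorem even_length_of_isCycle_commonNeighborGraph {V : Type*} [Finite V] {K : SimpleGraph V}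
    {A : Set V} (hK : Multi4 K) (hbip : Bipartition K A)
    (hdeg : ∀ u : V, 3 ≤ (K.neighborSet u).ncard → u ∉ A) {p : V}
    (C : (commonNeighborGraph K A).Walk p p) (hC : C.IsCycle) : Even C.length := by
  cases C with
  | nil => simp
  | @cons _ r _ h W =>
    rw [Walk.cons_isCycle_iff] at hC
    obtain ⟨L, hlen, hβ, hα, hpath⟩ := exists_lift_walk_of_commonNeighborGraph hbip hdeg W
    obtain ⟨hpr, hpA, hrA, x, hpx, hxr⟩ := id h
    have hxA : x ∈ A := by have := hbip hpx; tauto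
    have hxL : x ∉ L.support := by
      intro hx
      obtain ⟨u, w, he, hu, hw⟩ := hα x hx hxA hrA
      have huw : u ≠ w := (W.adj_of_mem_edges he).ne
      have hx3 : ¬ 3 ≤ (K.neighborSet x).ncard := fun h3 => hdeg x h3 hxA
      apply hC.2
      rcases eq_or_eq_of_adj_of_not_three_le_ncard hx3 huw hu hw hpx.symm with rfl | rfl <;>
      rcases eq_or_eq_of_adj_of_not_three_le_ncard hx3 huw hu hw hxr with rfl | rfl
      · exact absurd rfl hpr
      · exact he
      · rwa [Sym2.eq_swap]
      · exact absurd rfl hpr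
    have hcyc : (Walk.cons hpx (.cons hxr L)).IsCycle := by
      rw [Walk.cons_isCycle_iff, Walk.cons_isPath_iff]
      refine ⟨⟨hpath hC.1, hxL⟩, ?_⟩
      simp only [Walk.edges_cons, List.mem_cons, not_or]
      refine ⟨?_, fun he => hxL (L.snd_mem_support_of_mem_edges he)⟩
      rw [Sym2.eq_swap]
      simp [hpr, hxr.ne]
    have h4 := hK _ hcyc
    simp only [Walk.length_cons, hlen] at h4 ⊢
    rw [Nat.even_iff]
    omega

/-- Claim (A) in the proof of Theorem 2.2.  If `K` is a connected
subgraph of `G` all of whose vertices of degree at least 3 *in `K`* are of type β,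
then there is a 2-colouring of the type-β vertices — encoded as a total colouring `f`
agreeing with `a` on `A` — such that: (a) no cycle of `K` is monochromatic; (b) along
every path of `K` with both endpoints of type β the type-β vertices are coloured
alternately; and (c) if `v` belongs to `K` then `f v = c`. -/
theorem exists_good_colouring_beta_branch_subgraph {V : Type*} [Fintype V] [DecidableEq V]
    (G : SimpleGraph V) [DecidableRel G.Adj] (A : Set V)
    (hG : Multi4 G) (hbip : Bipartition G A)
    (v : V) (hv : v ∉ A) (a : V → Fin 2) (c : Fin 2)
    (K : G.Subgraph) (hKconn : K.Connected)
    (hKdeg : ∀ u : V, 3 ≤ (K.neighborSet u).ncard → u ∉ A) :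
    ∃ f : V → Fin 2, (∀ w ∈ A, f w = a w) ∧
      (∀ (u : V) (cy : K.spanningCoe.Walk u u), cy.IsCycle →
        ¬ (∀ p ∈ cy.support, ∀ q ∈ cy.support, f p = f q)) ∧
      (∀ (p q : V) (P : K.spanningCoe.Walk p q), P.IsPath → p ∉ A → q ∉ A →
        ∀ i : ℕ, i + 2 ≤ P.length → P.getVert i ∉ A →
          f (P.getVert i) ≠ f (P.getVert (i + 2))) ∧
      (v ∈ K.verts → f v = c) := by
  have hKG : K.spanningCoe ≤ G := K.spanningCoe_le
  have hbipK : Bipartition K.spanningCoe A := fun _ _ h => hbip (hKG h)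
  have hK : Multi4 K.spanningCoe := fun u cy hcy => by
    simpa using hG (cy.mapLe hKG) (hcy.mapLe hKG)
  obtain ⟨col⟩ : (commonNeighborGraph K.spanningCoe A).Colorable 2 :=
    colorable_two_of_forall_isCycle_even fun _ C hC =>
      even_length_of_isCycle_commonNeighborGraph hK hbipK hKdeg C hC
  classical
  let f : V → Fin 2 := fun w => if w ∈ A then a w else col w + (c - col v)
  have hf : ∀ {x y z : V}, x ≠ z → K.spanningCoe.Adj x y → K.spanningCoe.Adj y z → x ∉ A →
      f x ≠ f z := by
    intro x y z hne hxy hyz hx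
    have hz : z ∉ A := by have := hbipK hxy; have := hbipK hyz; tauto
    have hcol : col x ≠ col z := col.valid ⟨hne, hx, hz, y, hxy, hyz⟩
    simpa [f, hx, hz] using hcol
  refine ⟨f, fun w hw => by simp [f, hw], ?_, ?_, fun _ => by simp [f, hv]⟩
  · intro u cy hcy hmono
    have hlen : 4 ≤ cy.length := Nat.le_of_dvd (by have := hcy.three_le_length; omega) (hK cy hcy)
    have key : ∀ i, 1 ≤ i → i + 2 ≤ cy.length → cy.getVert i ∈ A := by
      intro i h1 h2
      by_contra hi
      refine hf (fun h => ?_) (cy.adj_getVert_succ (i := i) (by omega))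
        (cy.adj_getVert_succ (i := i + 1) (by omega)) hi
        (hmono _ (cy.getVert_mem_support _) _ (cy.getVert_mem_support _))
      have := hcy.getVert_injOn (by simp; omega) (by simp; omega) h
      omega
    exact (hbipK (cy.adj_getVert_succ (i := 1) (by omega))).1 (key 1 le_rfl (by omega))
      (key 2 (by omega) (by omega))
  · intro p q P hP _ _ i hi hiA
    refine hf (fun h => ?_) (P.adj_getVert_succ (i := i) (by omega))
      (P.adj_getVert_succ (i := i + 1) (by omega)) hiA
    have := hP.getVert_injOn (by simp; omega) (by simp; omega) h
    omega
end

section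
/- Consider the complete bipartite graph K_{3,4} with parts A of size 4 and B of size 3. There exists a 2-colouring a : A → {1, 2} assigning colour 1 to exactly two vertices of A and colour 2 to the other two, such that for every 2-colouring b : B → {1, 2} some cycle of K_{3,4} is monochromatic with respect to the combined colouring a ▽ b. Moreover, K_{3,4} contains a cycle whose length is not divisible by 4, so K_{3,4} is not a graph with multi-4-cycles. -/
open SimpleGraph

/-- Two distinct vertices on each side of a complete bipartite graph lie on a common 4-cycle. -/
theorem completeBipartiteGraph_exists_isCycle_support_eq {V W : Type*} {i j : V} {k l : W}
    (hij : i ≠ j) (hkl : k ≠ l) :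
    ∃ c : (completeBipartiteGraph V W).Walk (Sum.inl i) (Sum.inl i), c.IsCycle ∧
      c.support = [Sum.inl i, Sum.inr k, Sum.inl j, Sum.inr l, Sum.inl i] := by
  refine ⟨.cons (v := Sum.inr k) (by simp) (.cons (v := Sum.inl j) (by simp)
    (.cons (v := Sum.inr l) (by simp) (.cons (by simp) .nil))), ?_, by simp⟩
  simp [Walk.isCycle_def, Walk.isTrail_def, hij, hkl, hij.symm]

/-- Three distinct vertices on each side of a complete bipartite graph lie on a common 6-cycle. -/
theorem completeBipartiteGraph_exists_isCycle_length_eq_six {V W : Type*} {i j m : V} {k l n : W}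
    (hij : i ≠ j) (him : i ≠ m) (hjm : j ≠ m) (hkl : k ≠ l) (hkn : k ≠ n) (hln : l ≠ n) :
    ∃ c : (completeBipartiteGraph V W).Walk (Sum.inl i) (Sum.inl i),
      c.IsCycle ∧ c.length = 6 := by
  refine ⟨.cons (v := Sum.inr k) (by simp) (.cons (v := Sum.inl j) (by simp)
    (.cons (v := Sum.inr l) (by simp) (.cons (v := Sum.inl m) (by simp)
    (.cons (v := Sum.inr n) (by simp) (.cons (by simp) .nil))))), ?_, by simp⟩
  simp [Walk.isCycle_def, Walk.isTrail_def, hij, him, hjm, hkl, hkn, hln,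
    hij.symm, him.symm]

/-- Example 1.1.  In `K₃,₄` (with part `A` of size 4 and part `B`
of size 3) there is a 2-colouring `a` of the size-4 part, with exactly two vertices of
each colour, such that for every 2-colouring `b` of the size-3 part some cycle is
monochromatic with respect to the combined colouring `a ▽ b`; moreover `K₃,₄` has a
cycle of length not divisible by 4, so it does not have multi-4-cycles. -/
theorem K34_counterexample :
    (∃ a : Fin 4 → Fin 2, (Finset.univ.filter fun j => a j = 0).card = 2 ∧
      ∀ b : Fin 3 → Fin 2, ∃ (u : Fin 3 ⊕ Fin 4)
        (c : (completeBipartiteGraph (Fin 3) (Fin 4)).Walk u u), c.IsCycle ∧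
          ∀ p ∈ c.support, ∀ q ∈ c.support, Sum.elim b a p = Sum.elim b a q) ∧
    (∃ (u : Fin 3 ⊕ Fin 4) (c : (completeBipartiteGraph (Fin 3) (Fin 4)).Walk u u),
      c.IsCycle ∧ ¬ 4 ∣ c.length) ∧
    ¬ Multi4 (completeBipartiteGraph (Fin 3) (Fin 4)) := by
  obtain ⟨c, hc, hlen⟩ := completeBipartiteGraph_exists_isCycle_length_eq_six
    (i := (0 : Fin 3)) (j := 1) (m := 2) (k := (0 : Fin 4)) (l := 1) (n := 2)
    (by decide) (by decide) (by decide) (by decide) (by decide) (by decide)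
  have hdvd : ¬ 4 ∣ c.length := by omega
  refine ⟨⟨![0, 0, 1, 1], by decide, fun b => ?_⟩, ⟨_, c, hc, hdvd⟩, fun h => hdvd (h c hc)⟩
  obtain ⟨i, j, hij, hb⟩ := Fintype.exists_ne_map_eq_of_card_lt b (by decide)
  obtain ⟨k, l, hkl, hk, hl⟩ : ∃ k l : Fin 4, k ≠ l ∧
      (![0, 0, 1, 1] : Fin 4 → Fin 2) k = b i ∧ (![0, 0, 1, 1] : Fin 4 → Fin 2) l = b i := by
    generalize b i = x
    revert x
    decide
  obtain ⟨d, hd, hsupp⟩ := completeBipartiteGraph_exists_isCycle_support_eq hij hkl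
  have hcol : ∀ p ∈ d.support, Sum.elim b ![0, 0, 1, 1] p = b i := by
    simp [hsupp, hk, hl, hb]
  exact ⟨_, d, hd, fun p hp q hq => (hcol p hp).trans (hcol q hq).symm⟩
end
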